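/- Let T = σ₂∘σ₁ be a linear involution. For every nonempty word u ∈ L(T), one has I_{u⁻¹} = σ₁(T^{|u|−1}(I_u)), where u⁻¹ is the inverse of u in the free group F_A. Consequently the natural coding L(T) is closed under taking inverses, and hence is a laminary set on A. -/

import Mathlib

open Set

namespace LinInv

/-- A letter of the extended alphabet `A ∪ A⁻¹`, encoded as a pair of a letter
of `A` and a sign. -/
abbrev Letter (A : Type*) := A × Bool

/-- The formal inverse of a letter. -/
def Letter.inv {A : Type*} (c : Letter A) : Letter A := (c.1, !c.2)

/-- The inverse of a word over `A ∪ A⁻¹`. -/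
def wordInv {A : Type*} (u : List (Letter A)) : List (Letter A) :=
  (u.map Letter.inv).reverse

/-- The involution `σ₂` exchanging the two components of `Î = I × {0,1}`. -/
def s2 (z : ℝ × Bool) : ℝ × Bool := (z.1, !z.2)

/-- A linear involution on the alphabet `A`: the open interval `I = ]lo,hi[`,
for each `c ∈ A ∪ A⁻¹` an open subinterval `I_c = ]endLo c, endHi c[ × {comp c}`
of one of the two components of `Î = I × {0,1}`, the finite set `Sig` of division
points, and the first involution `σ₁`, subject to the defining conditions. -/
structure LinearInvolution (A : Type*) [Fintype A] where
  lo : ℝ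
  hi : ℝ
  lo_lt_hi : lo < hi
  endLo : Letter A → ℝ
  endHi : Letter A → ℝ
  end_lt : ∀ c, endLo c < endHi c
  comp : Letter A → Bool
  sub_lo : ∀ c, lo ≤ endLo c
  sub_hi : ∀ c, endHi c ≤ hi
  /-- the length data satisfy `λ_a = λ_{a⁻¹}` -/
  len_inv : ∀ c, endHi c - endLo c = endHi (Letter.inv c) - endLo (Letter.inv c)
  /-- the set of division points -/
  Sig : Set (ℝ × Bool)
  Sig_sub : Sig ⊆ Ioo lo hi ×ˢ (univ : Set Bool)
  /-- there are `2k-2` division points -/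
  Sig_card : Sig.ncard = 2 * Fintype.card A - 2
  /-- the intervals `I_c` are pairwise disjoint -/
  disj : ∀ c d : Letter A, c ≠ d →
    Disjoint (Ioo (endLo c) (endHi c) ×ˢ ({comp c} : Set Bool))
      (Ioo (endLo d) (endHi d) ×ˢ ({comp d} : Set Bool))
  Sig_disj : ∀ c : Letter A,
    Disjoint Sig (Ioo (endLo c) (endHi c) ×ˢ ({comp c} : Set Bool))
  /-- the intervals `I_c` partition `Î` minus the division points -/
  cover : Ioo lo hi ×ˢ (univ : Set Bool) =
    (⋃ c : Letter A, Ioo (endLo c) (endHi c) ×ˢ ({comp c} : Set Bool)) ∪ Sig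
  /-- the first involution `σ₁` (as a total map; only its values on `Î ∖ Σ` matter) -/
  s1 : ℝ × Bool → ℝ × Bool
  s1_invol : ∀ z ∈ (Ioo lo hi ×ˢ (univ : Set Bool)) \ Sig, s1 (s1 z) = z
  /-- on each `I_c`, `σ₁` is either a translation or a symmetry -/
  s1_iso : ∀ c : Letter A,
    (∃ α : ℝ, ∀ z ∈ Ioo (endLo c) (endHi c) ×ˢ ({comp c} : Set Bool),
        s1 z = (z.1 + α, comp (Letter.inv c))) ∨
    (∃ α : ℝ, ∀ z ∈ Ioo (endLo c) (endHi c) ×ˢ ({comp c} : Set Bool),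
        s1 z = (-z.1 + α, comp (Letter.inv c)))
  /-- `σ₁` maps `I_c` onto `I_{c⁻¹}` -/
  s1_image : ∀ c : Letter A,
    s1 '' (Ioo (endLo c) (endHi c) ×ˢ ({comp c} : Set Bool)) =
      Ioo (endLo (Letter.inv c)) (endHi (Letter.inv c)) ×ˢ
        ({comp (Letter.inv c)} : Set Bool)

namespace LinearInvolution

variable {A : Type*} [Fintype A] (L : LinearInvolution A)

/-- The domain `Î = I × {0,1}`. -/
def Ihat : Set (ℝ × Bool) := Ioo L.lo L.hi ×ˢ (univ : Set Bool)

/-- The interval `I_c` associated with the letter `c ∈ A ∪ A⁻¹`. -/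
def Ia (c : Letter A) : Set (ℝ × Bool) :=
  Ioo (L.endLo c) (L.endHi c) ×ˢ ({L.comp c} : Set Bool)

/-- The linear involution `T = σ₂ ∘ σ₁`. -/
def T (z : ℝ × Bool) : ℝ × Bool := s2 (L.s1 z)

/-- `O = ⋃_{n ≥ 0} T⁻ⁿ(Σ)`, the negative orbit of the singular points. -/
def O : Set (ℝ × Bool) := ⋃ n : ℕ, (L.T)^[n] ⁻¹' L.Sig

/-- `Ô = O ∪ σ₂(O)`. -/
def Ohat : Set (ℝ × Bool) := L.O ∪ s2 '' L.O

/-- `T` has a connection if some singularity `x` of `T⁻¹` reaches a singularity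
`y` of `T` in `n ≥ 0` steps. -/
def HasConnection : Prop := ∃ x ∈ s2 '' L.Sig, ∃ n : ℕ, (L.T)^[n] x ∈ L.Sig

/-- `T` is nonorientable if some `I_c` and `I_{c⁻¹}` lie in the same component. -/
def Nonorientable : Prop := ∃ c : Letter A, L.comp c = L.comp (Letter.inv c)

/-- `T` is orientable if it is not nonorientable. -/
def Orientable : Prop := ¬ L.Nonorientable

/-- `u` occurs in the natural coding of the orbit of `z` at position `m`. -/
def IsCodingFrom (z : ℝ × Bool) (m : ℕ) (u : List (Letter A)) : Prop :=
  ∀ i : Fin u.length, (L.T)^[m + i.1] z ∈ L.Ia (u.get i)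

/-- The natural coding `L(T)`: the set of factors of the infinite natural
codings `Σ_T(z)` for `z ∈ Î ∖ Ô`. -/
def lang : Set (List (Letter A)) :=
  {u | ∃ z ∈ L.Ihat \ L.Ohat, ∃ m : ℕ, L.IsCodingFrom z m u}

/-- The interval `I_w = I_{a₀} ∩ T⁻¹(I_{a₁}) ∩ ⋯ ∩ T^{-m+1}(I_{a_{m-1}})`
associated with a word `w = a₀a₁⋯a_{m-1}`; by convention `I_ε = Î`. -/
def Iw (u : List (Letter A)) : Set (ℝ × Bool) :=
  L.Ihat ∩ ⋂ i : Fin u.length, (L.T)^[i.1] ⁻¹' L.Ia (u.get i)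

/-- The return time `ρ_X(x) = inf {n ≥ 1 ∣ Tⁿ(x) ∈ X}`, with value `∞` if the
orbit of `x` never returns to `X`. -/
noncomputable def retTime (X : Set (ℝ × Bool)) (x : ℝ × Bool) : ℕ∞ :=
  sInf {n : ℕ∞ | ∃ m : ℕ, n = (m : ℕ∞) ∧ 1 ≤ m ∧ (L.T)^[m] x ∈ X}

/-- A word is even if it has an even number of odd letters (a letter `a` is odd
when `I_a` and `I_{a⁻¹}` lie in the same component). -/
def EvenWord (u : List (Letter A)) : Prop :=
  Even (u.countP fun c => L.comp (c.1, true) == L.comp (c.1, false))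

/-- The morphism `F_A → ℤ/2ℤ` sending each odd letter to `1` and each even
letter to `0`. -/
noncomputable def evenHom : FreeGroup A →* Multiplicative (ZMod 2) :=
  FreeGroup.lift fun a =>
    Multiplicative.ofAdd (if L.comp (a, true) = L.comp (a, false) then (1 : ZMod 2) else 0)

/-- The even group: the subgroup of `F_A` formed by the even elements. -/
noncomputable def evenGroup : Subgroup (FreeGroup A) := (L.evenHom).ker

/-- The admissibility condition at an endpoint `x` of an interval `J`:
either `x = Tⁿ(z)` for a singularity `z` of `T⁻¹` with `T^k(z) ∉ J` for
`0 ≤ k ≤ n`, or `Tⁿ(x) = z` for a singularity `z` of `T` with `T^k(x) ∉ J`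
for `0 ≤ k ≤ n`. -/
def AdmissibleEndpoint (J : Set (ℝ × Bool)) (x : ℝ × Bool) : Prop :=
  (∃ z ∈ s2 '' L.Sig, ∃ n : ℕ, (L.T)^[n] z = x ∧ ∀ k ≤ n, (L.T)^[k] z ∉ J) ∨
  (∃ z ∈ L.Sig, ∃ n : ℕ, (L.T)^[n] x = z ∧ ∀ k ≤ n, (L.T)^[k] x ∉ J)

/-- The open interval `]u,v[ × {δ}` is admissible with respect to `T`. -/
def AdmissibleInterval (u v : ℝ) (δ : Bool) : Prop :=
  u < v ∧ L.AdmissibleEndpoint (Ioo u v ×ˢ ({δ} : Set Bool)) (u, δ) ∧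
    L.AdmissibleEndpoint (Ioo u v ×ˢ ({δ} : Set Bool)) (v, δ)

end LinearInvolution

/-- A set of words is factorial if it contains the factors of its elements. -/
def FactorialSet {α : Type*} (S : Set (List α)) : Prop :=
  ∀ u ∈ S, ∀ v : List α, v <:+: u → v ∈ S

/-- A word over `A ∪ A⁻¹` is reduced if it has no factor `c c⁻¹`. -/
def Reduced {A : Type*} (u : List (Letter A)) : Prop :=
  u.Chain' fun c d => d ≠ Letter.inv c

/-- A laminary set on `A`: a symmetric factorial set of reduced words on
`A ∪ A⁻¹`. -/
def Laminary {A : Type*} (S : Set (List (Letter A))) : Prop :=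
  FactorialSet S ∧ (∀ u ∈ S, wordInv u ∈ S) ∧ ∀ u ∈ S, Reduced u

/-- A laminary set is orientable if it splits as `S₊ ∪ S₋` with `S₊, S₋`
factorial, `S₊ ∩ S₋ = {ε}`, and `x ∈ S₋ ↔ x⁻¹ ∈ S₊`. -/
def OrientableSet {A : Type*} (S : Set (List (Letter A))) : Prop :=
  ∃ Sp Sm : Set (List (Letter A)), FactorialSet Sp ∧ FactorialSet Sm ∧
    S = Sp ∪ Sm ∧ Sp ∩ Sm = {([] : List (Letter A))} ∧
    ∀ x ∈ S, (x ∈ Sm ↔ wordInv x ∈ Sp)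

/-- A set of words is uniformly recurrent if it is right extendable and every
`u ∈ S` occurs in every long enough word of `S`. -/
def UniformlyRecurrent {α : Type*} (S : Set (List α)) : Prop :=
  (∀ u ∈ S, ∃ c : α, u ++ [c] ∈ S) ∧
  ∀ u ∈ S, ∃ n : ℕ, 1 ≤ n ∧ ∀ w ∈ S, w.length = n → u <:+: w

/-- A set of words over `A ∪ A⁻¹` is uniformly semi-recurrent if it is right
extendable and for every `u ∈ S`, every long enough word of `S` contains `u` or
`u⁻¹` as a factor. -/
def UniformlySemiRecurrent {A : Type*} (S : Set (List (Letter A))) : Prop :=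
  (∀ u ∈ S, ∃ c : Letter A, u ++ [c] ∈ S) ∧
  ∀ u ∈ S, ∃ n : ℕ, 1 ≤ n ∧ ∀ w ∈ S, w.length = n → (u <:+: w ∨ wordInv u <:+: w)

/-- A laminary set is semi-recurrent if for all `u, w ∈ S` there is `v ∈ S`
with `uvw ∈ S` or `uvw⁻¹ ∈ S`. -/
def SemiRecurrent {A : Type*} (S : Set (List (Letter A))) : Prop :=
  ∀ u ∈ S, ∀ w ∈ S, ∃ v ∈ S, u ++ v ++ w ∈ S ∨ u ++ v ++ wordInv w ∈ S

/-- A complete return word to `X ⊆ S`: a word of `S` with a proper prefix in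
`X` and a proper suffix in `X`. -/
def CompleteReturnWord {α : Type*} (S X : Set (List α)) (u : List α) : Prop :=
  u ∈ S ∧ (∃ p ∈ X, p <+: u ∧ p ≠ u) ∧ (∃ s ∈ X, s <:+ u ∧ s ≠ u)

/-- A complete first return word to `X`: a complete return word to `X` with no
internal factor in `X`. -/
def CompleteFirstReturnWord {α : Type*} (S X : Set (List α)) (u : List α) : Prop :=
  CompleteReturnWord S X u ∧
    ¬ ∃ p v s : List α, u = p ++ v ++ s ∧ v ∈ X ∧ p ≠ [] ∧ s ≠ []

/-- `CR S w`: the set of complete first return words to `{w, w⁻¹}` in `S`. -/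
def CR {A : Type*} (S : Set (List (Letter A))) (w : List (Letter A)) :
    Set (List (Letter A)) :=
  {u | CompleteFirstReturnWord S {w, wordInv w} u}

open Classical in
/-- The operation `N` on complete return words to `{w, w⁻¹}`: erase the prefix
`w` if present, and erase the suffix `w⁻¹` if present. -/
noncomputable def NN {A : Type*} (w u : List (Letter A)) : List (Letter A) :=
  let u' := if w <+: u then u.drop w.length else u
  if wordInv w <:+ u' then u'.take (u'.length - w.length) else u'

/-- `MR S w`: the set of mixed first return words to `w` in `S`. -/
noncomputable def MR {A : Type*} (S : Set (List (Letter A))) (w : List (Letter A)) :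
    Set (List (Letter A)) :=
  NN w '' CR S w

/-- `RightReturn S w`: the set of first right return words to `w` in `S`,
i.e. the words `u` such that `wu` is a complete first return word to `{w}`. -/
def RightReturn {α : Type*} (S : Set (List α)) (w : List α) : Set (List α) :=
  {u | CompleteFirstReturnWord S {w} (w ++ u)}

/-- `X` is a basis (free generating set) of the subgroup `H`: the canonical map
`FreeGroup X → G` is injective with range `H`. -/
def IsBasisOf {G : Type*} [Group G] (X : Set G) (H : Subgroup G) : Prop :=
  Function.Injective (FreeGroup.lift (fun x : X => (x : G))) ∧
    (FreeGroup.lift (fun x : X => (x : G)) : FreeGroup X →* G).range = H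

/-- `Y` is a symmetric basis of `H` if `Y = X ∪ X⁻¹` for some basis `X` of `H`. -/
def IsSymmetricBasisOf {G : Type*} [Group G] (Y : Set G) (H : Subgroup G) : Prop :=
  ∃ X : Set G, IsBasisOf X H ∧ Y = X ∪ X⁻¹

/-- The prime words in `S` with respect to a subgroup `G` of `F_A`: the
nonempty words of `G ∩ S` without a proper nonempty prefix in `G ∩ S`. -/
def PrimeWords {A : Type*} (S : Set (List (Letter A))) (G : Subgroup (FreeGroup A)) :
    Set (List (Letter A)) :=
  {u | u ∈ S ∧ u ≠ [] ∧ FreeGroup.mk u ∈ G ∧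
    ∀ p : List (Letter A), p <+: u → p ≠ [] → p ≠ u → ¬(p ∈ S ∧ FreeGroup.mk p ∈ G)}

theorem Letter.inv_inv {A : Type*} (c : Letter A) : c.inv.inv = c := by
  simp [Letter.inv]

theorem length_wordInv {A : Type*} (u : List (Letter A)) : (wordInv u).length = u.length := by
  simp [wordInv]

theorem wordInv_wordInv {A : Type*} (u : List (Letter A)) : wordInv (wordInv u) = u := by
  simp [wordInv, Function.comp_def, Letter.inv_inv]

theorem wordInv_eq_nil {A : Type*} {u : List (Letter A)} : wordInv u = [] ↔ u = [] := by
  simp [wordInv]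

theorem s2_s2 (z : ℝ × Bool) : s2 (s2 z) = z := by simp [s2]

namespace LinearInvolution

variable {A : Type*} [Fintype A] (L : LinearInvolution A)

theorem Ia_subset_Ihat (c : Letter A) : L.Ia c ⊆ L.Ihat := fun _ hz =>
  ⟨⟨(L.sub_lo c).trans_lt hz.1.1, hz.1.2.trans_le (L.sub_hi c)⟩, trivial⟩

theorem notMem_Sig_of_mem_Ia {c : Letter A} {z : ℝ × Bool} (hz : z ∈ L.Ia c) : z ∉ L.Sig :=
  fun h => Set.disjoint_left.1 (L.Sig_disj c) h hz

theorem exists_mem_Ia {z : ℝ × Bool} (hz : z ∈ L.Ihat) (hS : z ∉ L.Sig) : ∃ c, z ∈ L.Ia c := by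
  have h : z ∈ (⋃ c : Letter A, L.Ia c) ∪ L.Sig := L.cover ▸ hz
  exact Set.mem_iUnion.1 (h.resolve_right hS)

theorem s1_mem_Ia {c : Letter A} {z : ℝ × Bool} (hz : z ∈ L.Ia c) : L.s1 z ∈ L.Ia c.inv :=
  (L.s1_image c).subset ⟨z, hz, rfl⟩

theorem s1_s1_of_mem_Ia {c : Letter A} {z : ℝ × Bool} (hz : z ∈ L.Ia c) : L.s1 (L.s1 z) = z :=
  L.s1_invol z ⟨L.Ia_subset_Ihat c hz, L.notMem_Sig_of_mem_Ia hz⟩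

theorem T_s1_of_mem_Ia {c : Letter A} {z : ℝ × Bool} (hz : z ∈ L.Ia c) :
    L.T (L.s1 z) = s2 z := by
  rw [T, L.s1_s1_of_mem_Ia hz]

theorem T_notMem_Ia_inv {c : Letter A} {z : ℝ × Bool} (hz : z ∈ L.Ia c) :
    L.T z ∉ L.Ia c.inv := by
  intro h
  have h1 : (L.s1 z).2 = L.comp c.inv := (L.s1_mem_Ia hz).2
  have h2 : (!(L.s1 z).2) = L.comp c.inv := h.2
  simp [h1] at h2

/-- Applying `σ₁` to a point of an orbit reverses the orbit. -/
theorem iterate_T_s1 {z : ℝ × Bool} (n j : ℕ)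
    (h : ∀ i ≤ n + j, ∃ c, L.T^[i] z ∈ L.Ia c) :
    L.T^[j] (L.s1 (L.T^[n + j] z)) = L.s1 (L.T^[n] z) := by
  induction j with
  | zero => rfl
  | succ j ih =>
    obtain ⟨c, hc⟩ := h (n + (j + 1)) le_rfl
    rw [Function.iterate_succ_apply, L.T_s1_of_mem_Ia hc, ← add_assoc,
      Function.iterate_succ_apply', T, s2_s2]
    exact ih fun i hi => h i (by omega)

theorem isCodingFrom_iff {z : ℝ × Bool} {m : ℕ} {u : List (Letter A)} :
    L.IsCodingFrom z m u ↔ ∀ i (hi : i < u.length), L.T^[m + i] z ∈ L.Ia u[i] :=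
  ⟨fun h i hi => h ⟨i, hi⟩, fun h i => h i.1 i.2⟩

theorem isCodingFrom_iterate {z : ℝ × Bool} {m n : ℕ} {u : List (Letter A)} :
    L.IsCodingFrom (L.T^[n] z) m u ↔ L.IsCodingFrom z (m + n) u := by
  simp only [isCodingFrom_iff, ← Function.iterate_add_apply, add_right_comm]

theorem mem_Iw {z : ℝ × Bool} {u : List (Letter A)} (hu : u ≠ []) :
    z ∈ L.Iw u ↔ L.IsCodingFrom z 0 u := by
  have h : z ∈ L.Iw u ↔ z ∈ L.Ihat ∧ L.IsCodingFrom z 0 u := by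
    simp [Iw, IsCodingFrom]
  rw [h, and_iff_right_iff_imp]
  intro hc
  exact L.Ia_subset_Ihat _ (hc ⟨0, List.length_pos_iff.2 hu⟩)

theorem IsCodingFrom.exists_mem_Ia {L : LinearInvolution A} {z : ℝ × Bool}
    {u : List (Letter A)} (h : L.IsCodingFrom z 0 u) {i : ℕ} (hi : i < u.length) :
    ∃ c, L.T^[i] z ∈ L.Ia c :=
  ⟨u[i], by simpa using L.isCodingFrom_iff.1 h i hi⟩

theorem IsCodingFrom.wordInv {L : LinearInvolution A} {z : ℝ × Bool} {u : List (Letter A)}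
    (h : L.IsCodingFrom z 0 u) :
    L.IsCodingFrom (L.s1 (L.T^[u.length - 1] z)) 0 (wordInv u) := by
  rw [isCodingFrom_iff]
  intro i hi
  have hi' : i < u.length := length_wordInv u ▸ hi
  have key := L.iterate_T_s1 (z := z) (u.length - 1 - i) i
    fun j hj => h.exists_mem_Ia (by omega)
  rw [Nat.sub_add_cancel (by omega)] at key
  rw [zero_add, key]
  have hmem := L.s1_mem_Ia (L.isCodingFrom_iff.1 h (u.length - 1 - i) (by omega))
  simpa [LinInv.wordInv] using hmem

theorem IsCodingFrom.s1_iterate_s1_iterate {L : LinearInvolution A} {z : ℝ × Bool}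
    {u : List (Letter A)} (h : L.IsCodingFrom z 0 u) (hu : u ≠ []) :
    L.s1 (L.T^[u.length - 1] (L.s1 (L.T^[u.length - 1] z))) = z := by
  have hpos := List.length_pos_iff.2 hu
  have key := L.iterate_T_s1 (z := z) 0 (u.length - 1) fun j hj => h.exists_mem_Ia (by omega)
  rw [zero_add] at key
  obtain ⟨c, hc⟩ := h.exists_mem_Ia hpos
  rw [key]
  exact L.s1_s1_of_mem_Ia hc

theorem Iw_wordInv {u : List (Letter A)} (hu : u ≠ []) :
    L.Iw (wordInv u) = L.s1 '' (L.T^[u.length - 1] '' L.Iw u) := by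
  have hu' : wordInv u ≠ [] := mt wordInv_eq_nil.1 hu
  rw [Set.image_image]
  ext v
  constructor
  · intro hv
    rw [L.mem_Iw hu'] at hv
    refine ⟨L.s1 (L.T^[u.length - 1] v), (L.mem_Iw hu).2 ?_, ?_⟩
    · simpa only [length_wordInv, wordInv_wordInv] using hv.wordInv
    · simpa only [length_wordInv] using hv.s1_iterate_s1_iterate hu'
  · rintro ⟨z, hz, rfl⟩
    exact (L.mem_Iw hu').2 ((L.mem_Iw hu).1 hz).wordInv

theorem mem_O_iff {z : ℝ × Bool} : z ∈ L.O ↔ z ∈ L.Sig ∨ L.T z ∈ L.O := by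
  simp only [O, Set.mem_iUnion, Set.mem_preimage]
  rw [← Nat.or_exists_add_one]
  rfl

theorem mem_Ihat_diff_Ohat_iff {z : ℝ × Bool} :
    z ∈ L.Ihat \ L.Ohat ↔ z ∈ L.Ihat ∧ z ∉ L.O ∧ s2 z ∉ L.O := by
  have h : z ∈ s2 '' L.O ↔ s2 z ∈ L.O :=
    ⟨by rintro ⟨y, hy, rfl⟩; rwa [s2_s2], fun h => ⟨s2 z, h, s2_s2 z⟩⟩
  rw [Set.mem_sdiff, Ohat, Set.mem_union, h, not_or]

theorem s2_mem_Ihat_diff_Ohat {z : ℝ × Bool} (hz : z ∈ L.Ihat \ L.Ohat) :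
    s2 z ∈ L.Ihat \ L.Ohat := by
  rw [mem_Ihat_diff_Ohat_iff] at hz ⊢
  exact ⟨⟨hz.1.1, trivial⟩, hz.2.2, by rw [s2_s2]; exact hz.2.1⟩

theorem s1_mem_Ihat_diff_Ohat {z : ℝ × Bool} (hz : z ∈ L.Ihat \ L.Ohat) :
    L.s1 z ∈ L.Ihat \ L.Ohat := by
  rw [mem_Ihat_diff_Ohat_iff] at hz ⊢
  obtain ⟨hI, hO, hO'⟩ := hz
  rw [mem_O_iff, not_or] at hO
  obtain ⟨c, hc⟩ := L.exists_mem_Ia hI hO.1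
  have hs := L.s1_mem_Ia hc
  refine ⟨L.Ia_subset_Ihat _ hs, ?_, hO.2⟩
  rw [mem_O_iff, L.T_s1_of_mem_Ia hc, not_or]
  exact ⟨L.notMem_Sig_of_mem_Ia hs, hO'⟩

theorem iterate_T_mem_Ihat_diff_Ohat {z : ℝ × Bool} (hz : z ∈ L.Ihat \ L.Ohat) (n : ℕ) :
    L.T^[n] z ∈ L.Ihat \ L.Ohat := by
  induction n with
  | zero => exact hz
  | succ n ih =>
    rw [Function.iterate_succ_apply']
    exact L.s2_mem_Ihat_diff_Ohat (L.s1_mem_Ihat_diff_Ohat ih)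

theorem mem_lang_iff {u : List (Letter A)} :
    u ∈ L.lang ↔ ∃ z ∈ L.Ihat \ L.Ohat, L.IsCodingFrom z 0 u := by
  constructor
  · rintro ⟨z, hz, m, h⟩
    exact ⟨L.T^[m] z, L.iterate_T_mem_Ihat_diff_Ohat hz m,
      L.isCodingFrom_iterate.2 (by rwa [zero_add])⟩
  · rintro ⟨z, hz, h⟩
    exact ⟨z, hz, 0, h⟩

theorem wordInv_mem_lang {u : List (Letter A)} (hu : u ∈ L.lang) : wordInv u ∈ L.lang := by
  rw [mem_lang_iff] at hu ⊢
  obtain ⟨z, hz, h⟩ := hu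
  exact ⟨_, L.s1_mem_Ihat_diff_Ohat (L.iterate_T_mem_Ihat_diff_Ohat hz _), h.wordInv⟩

theorem factorialSet_lang : FactorialSet L.lang := by
  rintro _ ⟨z, hz, m, h⟩ v ⟨p, s, rfl⟩
  refine ⟨z, hz, m + p.length, ?_⟩
  rw [isCodingFrom_iff] at h ⊢
  intro i hi
  have := h (p.length + i) (by simp; omega)
  rw [add_assoc]
  simpa [List.getElem_append, hi] using this

theorem reduced_of_mem_lang {u : List (Letter A)} (hu : u ∈ L.lang) : Reduced u := by
  obtain ⟨z, -, m, h⟩ := hu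
  rw [isCodingFrom_iff] at h
  refine List.isChain_iff_getElem.2 fun i hi heq => ?_
  have h1 := h i (by omega)
  have h2 := h (i + 1) hi
  rw [heq, ← add_assoc, Function.iterate_succ_apply'] at h2
  exact L.T_notMem_Ia_inv h1 h2

theorem laminary_lang : Laminary L.lang :=
  ⟨L.factorialSet_lang, fun _ => L.wordInv_mem_lang, fun _ => L.reduced_of_mem_lang⟩

end LinearInvolution

/-- For nonempty `u ∈ L(T)`, `I_{u⁻¹} = σ₁(T^{|u|-1}(I_u))`;
consequently `L(T)` is closed under taking inverses and is a laminary set. -/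
theorem stmt_4 {A : Type*} [Fintype A] (L : LinearInvolution A) :
    (∀ u ∈ L.lang, u ≠ [] →
      L.Iw (wordInv u) = L.s1 '' ((L.T)^[u.length - 1] '' L.Iw u)) ∧
    (∀ u ∈ L.lang, wordInv u ∈ L.lang) ∧ Laminary L.lang :=
  ⟨fun _ _ hu => L.Iw_wordInv hu, fun _ => L.wordInv_mem_lang, L.laminary_lang⟩

end LinInv
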